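/- Let ζ_1 and ζ_2 be independent standard normal N(0,1) real random variables and let w ∈ ℂ be a complex number with nonzero imaginary part. Then E[ ζ_1 / (w ζ_1 + ζ_2) ] = 1/(w + i) if Im(w) > 0, and E[ ζ_1 / (w ζ_1 + ζ_2) ] = 1/(w − i) if Im(w) < 0. -/

import Mathlib

open MeasureTheory ProbabilityTheory Complex

open scoped Real in
/-- The expectation of a positively homogeneous function of degree zero under the standard
Gaussian measure on the plane is its average over the unit circle. -/
theorem integral_gaussianReal_prod_of_homogeneous {E : Type*} [NormedAddCommGroup E]
    [NormedSpace ℝ E] (f : ℝ × ℝ → E) (hf : ∀ r : ℝ, 0 < r → ∀ p, f (r • p) = f p) :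
    ∫ p, f p ∂((gaussianReal 0 1).prod (gaussianReal 0 1)) =
      (2 * π)⁻¹ • ∫ θ in -π..π, f (Real.cos θ, Real.sin θ) := by
  have hradial : ∫ r in Set.Ioi (0 : ℝ), (2 * π)⁻¹ * (r * Real.exp (-r ^ 2 / 2)) = (2 * π)⁻¹ := by
    have h := integral_mul_cexp_neg_mul_sq (b := (1 / 2 : ℂ)) (by norm_num)
    have h' : ∫ r in Set.Ioi (0 : ℝ), r * Real.exp (-r ^ 2 / 2) = 1 := by
      apply Complex.ofReal_injective
      rw [← integral_complex_ofReal]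
      refine Eq.trans (integral_congr_ae (ae_of_all _ fun r ↦ ?_)) (h.trans (by norm_num))
      push_cast
      ring_nf
    rw [integral_const_mul, h', mul_one]
  rw [gaussianReal_of_var_ne_zero 0 one_ne_zero,
    prod_withDensity (measurable_gaussianPDF _ _) (measurable_gaussianPDF _ _),
    integral_withDensity_eq_integral_toReal_smul (by fun_prop)
      (ae_of_all _ fun _ ↦ ENNReal.mul_lt_top gaussianPDF_lt_top gaussianPDF_lt_top),
    ← Measure.volume_eq_prod, ← integral_comp_polarCoord_symm]
  calc
    _ = ∫ p in Set.Ioi (0 : ℝ) ×ˢ Set.Ioo (-π) π,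
          ((2 * π)⁻¹ * (p.1 * Real.exp (-p.1 ^ 2 / 2))) • f (Real.cos p.2, Real.sin p.2) := by
      refine setIntegral_congr_fun (measurableSet_Ioi.prod measurableSet_Ioo) fun p hp ↦ ?_
      have hfp : f (polarCoord.symm p) = f (Real.cos p.2, Real.sin p.2) := by
        rw [← hf p.1 hp.1 (Real.cos p.2, Real.sin p.2)]
        simp
      have hexp : Real.exp (-(p.1 * Real.cos p.2) ^ 2 / 2) *
          Real.exp (-(p.1 * Real.sin p.2) ^ 2 / 2) = Real.exp (-p.1 ^ 2 / 2) := by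
        rw [← Real.exp_add]
        congr 1
        linear_combination (-p.1 ^ 2 / 2) * Real.sin_sq_add_cos_sq p.2
      have hsqrt : (√(2 * π))⁻¹ * (√(2 * π))⁻¹ = (2 * π)⁻¹ := by
        rw [← mul_inv, Real.mul_self_sqrt (by positivity)]
      rw [hfp, smul_smul, ENNReal.toReal_mul, toReal_gaussianPDF, toReal_gaussianPDF,
        ← hexp, ← hsqrt]
      simp only [gaussianPDFReal_def, polarCoord_symm_apply, NNReal.coe_one, mul_one, sub_zero]
      congr 1
      ring
    _ = _ := by
      rw [Measure.volume_eq_prod, ← Measure.prod_restrict,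
        integral_prod_smul (fun r : ℝ ↦ (2 * π)⁻¹ * (r * Real.exp (-r ^ 2 / 2)))
          (fun θ ↦ f (Real.cos θ, Real.sin θ)), hradial,
        intervalIntegral.integral_of_le (by linarith [Real.pi_pos]), integral_Ioc_eq_integral_Ioo]

theorem mul_ofReal_add_ofReal_ne_zero {w : ℂ} (hw : w.im ≠ 0) {x y : ℝ} (hxy : (x, y) ≠ 0) :
    w * x + y ≠ 0 := by
  intro h
  have hx : x = 0 := by simpa [hw] using congrArg Complex.im h
  have hy : y = 0 := by simpa [hx] using congrArg Complex.re h
  exact hxy (by simp [hx, hy])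

open scoped Real in
theorem integral_cos_div_mul_cos_add_sin {w : ℂ} (hw : 0 < w.im) :
    (2 * π)⁻¹ • ∫ θ in -π..π, (Real.cos θ : ℂ) / (w * (Real.cos θ : ℂ) + (Real.sin θ : ℂ)) =
      1 / (w + I) := by
  have hden : ∀ z ∈ Metric.closedBall (0 : ℂ) |1|, (w - I) * z ^ 2 + (w + I) ≠ 0 := by
    intro z hz h
    have hz1 : ‖z ^ 2‖ ≤ 1 := by
      rw [norm_pow]
      exact pow_le_one₀ (norm_nonneg z) (by simpa using hz)
    have hlt : ‖w - I‖ < ‖w + I‖ := by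
      rw [← sq_lt_sq₀ (norm_nonneg _) (norm_nonneg _), Complex.sq_norm, Complex.sq_norm,
        normSq_apply, normSq_apply]
      simp
      nlinarith
    have heq : ‖w - I‖ * ‖z ^ 2‖ = ‖w + I‖ := by
      rw [← norm_mul, eq_neg_of_add_eq_zero_left h, norm_neg]
    nlinarith [norm_nonneg (w - I)]
  have hdiff : DifferentiableOn ℂ (fun z : ℂ ↦ (z ^ 2 + 1) / ((w - I) * z ^ 2 + (w + I)))
      (Metric.closedBall 0 |1|) :=
    DifferentiableOn.div (by fun_prop) (by fun_prop) hden
  have hmean := (DifferentiableOn.diffContOnCl_ball (c := 0) hdiff subset_rfl).circleAverage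
  have hper : Function.Periodic
      (fun θ : ℝ ↦ (Real.cos θ : ℂ) / (w * (Real.cos θ : ℂ) + (Real.sin θ : ℂ))) (2 * π) :=
    fun θ ↦ by simp only [Real.cos_add_two_pi, Real.sin_add_two_pi]
  have hshift := hper.intervalIntegral_add_eq (-π) 0
  rw [zero_add, show -π + 2 * π = π by ring] at hshift
  rw [hshift]
  refine Eq.trans ?_ (hmean.trans (by simp))
  rw [Real.circleAverage_def]
  congr 1
  refine intervalIntegral.integral_congr fun θ _ ↦ ?_
  have hz : circleMap 0 1 θ = Real.cos θ + Real.sin θ * I := by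
    rw [circleMap_zero, exp_mul_I, ofReal_one, one_mul, ofReal_cos, ofReal_sin]
  have hpyth : (Real.cos θ : ℂ) ^ 2 + (Real.sin θ : ℂ) ^ 2 = 1 := by
    exact_mod_cast Real.cos_sq_add_sin_sq θ
  have hne : w * (Real.cos θ : ℂ) + (Real.sin θ : ℂ) ≠ 0 := by
    refine mul_ofReal_add_ofReal_ne_zero hw.ne' fun h ↦ ?_
    rw [Prod.mk_eq_zero] at h
    simpa [h.1, h.2] using Real.cos_sq_add_sin_sq θ
  have hne' := hden (circleMap 0 1 θ) (by simp)
  simp only [hz] at hne' ⊢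
  rw [div_eq_div_iff hne hne']
  linear_combination (norm := (ring_nf; simp only [I_sq, I_pow_three]; ring_nf))
    ((Real.sin θ : ℂ) - Real.cos θ * I) * hpyth

/-- The case of the upper half plane. -/
theorem integral_div_mul_add_of_indepFun_gaussianReal {Ω : Type*} [MeasurableSpace Ω]
    {μ : Measure Ω} [IsProbabilityMeasure μ] {X Y : Ω → ℝ} (hX : Measurable X) (hY : Measurable Y)
    (hXY : IndepFun X Y μ) (hX' : μ.map X = gaussianReal 0 1) (hY' : μ.map Y = gaussianReal 0 1)
    {w : ℂ} (hw : 0 < w.im) :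
    ∫ ω, (X ω : ℂ) / (w * (X ω : ℂ) + (Y ω : ℂ)) ∂μ = 1 / (w + I) := by
  let f : ℝ × ℝ → ℂ := fun p ↦ (p.1 : ℂ) / (w * (p.1 : ℂ) + (p.2 : ℂ))
  have hf : Measurable f := by fun_prop
  have hmap := (indepFun_iff_map_prod_eq_prod_map_map hX.aemeasurable hY.aemeasurable).1 hXY
  rw [hX', hY'] at hmap
  have hint := integral_map (hX.prodMk hY).aemeasurable (μ := μ) (f := f) hf.aestronglyMeasurable
  rw [hmap, integral_gaussianReal_prod_of_homogeneous f fun r hr p ↦ ?_] at hint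
  · exact hint.symm.trans (integral_cos_div_mul_cos_add_sin hw)
  · have hr' : (r : ℂ) ≠ 0 := ofReal_ne_zero.2 hr.ne'
    simp only [f, Prod.smul_fst, Prod.smul_snd, smul_eq_mul, ofReal_mul]
    rw [show w * (r * p.1) + r * p.2 = r * (w * p.1 + p.2) by ring, mul_div_mul_left _ _ hr']

/-- **(Vanderbei, key Gaussian computation.)** For independent standard normal real random
variables `ζ₁, ζ₂` and `w ∈ ℂ` with `Im w ≠ 0`,
`E[ζ₁/(wζ₁ + ζ₂)] = 1/(w+i)` if `Im w > 0` and `= 1/(w−i)` if `Im w < 0`. -/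
theorem gaussian_ratio_expectation
    {Ωp : Type*} [MeasureSpace Ωp] [IsProbabilityMeasure (ℙ : Measure Ωp)]
    (ζ₁ ζ₂ : Ωp → ℝ)
    (hmeas₁ : Measurable ζ₁) (hmeas₂ : Measurable ζ₂)
    (hindep : IndepFun ζ₁ ζ₂ ℙ)
    (hgauss₁ : Measure.map ζ₁ ℙ = gaussianReal 0 1)
    (hgauss₂ : Measure.map ζ₂ ℙ = gaussianReal 0 1)
    (w : ℂ) (hw : w.im ≠ 0) :
    (0 < w.im → ∫ ω, (ζ₁ ω : ℂ) / (w * (ζ₁ ω : ℂ) + (ζ₂ ω : ℂ)) ∂ℙ = 1 / (w + I)) ∧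
    (w.im < 0 → ∫ ω, (ζ₁ ω : ℂ) / (w * (ζ₁ ω : ℂ) + (ζ₂ ω : ℂ)) ∂ℙ = 1 / (w - I)) := by
  refine ⟨integral_div_mul_add_of_indepFun_gaussianReal hmeas₁ hmeas₂ hindep hgauss₁ hgauss₂,
    fun hneg ↦ ?_⟩
  have h := integral_div_mul_add_of_indepFun_gaussianReal hmeas₁ hmeas₂ hindep hgauss₁ hgauss₂
    (w := starRingEnd ℂ w) (by simpa using hneg)
  have hconj := congrArg (starRingEnd ℂ) h
  rw [← integral_conj] at hconj
  simpa [sub_eq_add_neg] using hconj
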